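/- arXiv:2512.13020 — 2 statements merged into one kernel-verified Lean document; each statement's English description precedes it below -/
import Mathlib

section
/- Let F be a field and m, n ≥ 0. Let B₁ ⊆ GL_m(F) and B₂ ⊆ GL_n(F) be the subgroups of invertible upper-triangular matrices, acting on the space Mat_{n×m}(F) of n×m matrices by (b₁, b₂)·T = b₂ T b₁⁻¹. Then for every T ∈ Mat_{n×m}(F) there is exactly one partial matching σ ∈ PM(m,n) such that T lies in the (B₁ × B₂)-orbit of the partial permutation matrix x_σ. In particular, σ ↦ (B₁ × B₂)·x_σ is a bijection from PM(m,n) onto the set of (B₁ × B₂)-orbits on Mat_{n×m}(F). -/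
open Matrix

/-- A finset `s ⊆ Fin m × Fin n` is (the graph of) a partial matching `(I, J, μ)`:
it is the graph of a bijection between a subset `I` of `{1,…,m}` and a subset `J`
of `{1,…,n}`. -/
def IsPartialMatching {m n : ℕ} (s : Finset (Fin m × Fin n)) : Prop :=
  ∀ p ∈ s, ∀ q ∈ s, p.1 = q.1 ↔ p.2 = q.2

/-- The partial permutation matrix `x_σ` attached to a partial matching `σ`:
the `(μ(i), i)` entries are `1` for `i ∈ I` and all other entries are `0`. -/
def pmMatrix (F : Type*) [Zero F] [One F] {m n : ℕ} (s : Finset (Fin m × Fin n)) :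
    Matrix (Fin n) (Fin m) F :=
  fun j i => if (i, j) ∈ s then 1 else 0

/-- Two matrices are Borel equivalent when they differ by invertible upper-triangular factors on
the left and on the right. -/
def BorelEquiv {F : Type*} [Field F] {m n : ℕ} (T T' : Matrix (Fin n) (Fin m) F) : Prop :=
  ∃ (b₁ : Matrix (Fin m) (Fin m) F) (b₂ : Matrix (Fin n) (Fin n) F),
    IsUnit b₁ ∧ IsUnit b₂ ∧ b₁.BlockTriangular id ∧ b₂.BlockTriangular id ∧ T = b₂ * T' * b₁

theorem BorelEquiv.refl {F : Type*} [Field F] {m n : ℕ} (T : Matrix (Fin n) (Fin m) F) :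
    BorelEquiv T T :=
  ⟨1, 1, isUnit_one, isUnit_one, blockTriangular_one, blockTriangular_one, by simp⟩

theorem BorelEquiv.trans {F : Type*} [Field F] {m n : ℕ} {T T' T'' : Matrix (Fin n) (Fin m) F}
    (h : BorelEquiv T T') (h' : BorelEquiv T' T'') : BorelEquiv T T'' := by
  obtain ⟨b₁, b₂, u₁, u₂, t₁, t₂, rfl⟩ := h
  obtain ⟨c₁, c₂, v₁, v₂, s₁, s₂, rfl⟩ := h'
  exact ⟨c₁ * b₁, b₂ * c₂, v₁.mul u₁, u₂.mul v₂, s₁.mul t₁, t₂.mul s₂, by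
    simp only [Matrix.mul_assoc]⟩

theorem Matrix.BlockTriangular.isUnit_iff {F : Type*} [Field F] {n : ℕ}
    {b : Matrix (Fin n) (Fin n) F} (hb : b.BlockTriangular id) :
    IsUnit b ↔ ∀ i, b i i ≠ 0 := by
  rw [Matrix.isUnit_iff_isUnit_det, det_of_isUpperTriangular hb, isUnit_iff_ne_zero,
    Finset.prod_ne_zero_iff]
  simp

theorem Matrix.BlockTriangular.nonsing_inv {F : Type*} [Field F] {n : ℕ}
    {b : Matrix (Fin n) (Fin n) F} (hb : b.BlockTriangular id) (hu : IsUnit b) :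
    b⁻¹.BlockTriangular id := by
  have := hu.invertible
  exact blockTriangular_inv_of_blockTriangular hb

/-- The matrix obtained from `T` by using the entry in row `r` and column `k` to clear the rest of
that row and column, and then replacing that entry by `1`. -/
def clearPivot {F : Type*} [Field F] {m n : ℕ} (T : Matrix (Fin n) (Fin m) F) (r : Fin n)
    (k : Fin m) : Matrix (Fin n) (Fin m) F :=
  of fun j i => T j i - T j k * (T r i / T r k) + if j = r ∧ i = k then 1 else 0

theorem borelEquiv_clearPivot {F : Type*} [Field F] {m n : ℕ} (T : Matrix (Fin n) (Fin m) F)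
    (r : Fin n) (k : Fin m) (hrk : T r k ≠ 0) (hcol : ∀ j, r < j → T j k = 0)
    (hrow : ∀ i, i < k → T r i = 0) : BorelEquiv T (clearPivot T r k) := by
  have t₁ : (updateRow (1 : Matrix (Fin m) (Fin m) F) k
      fun i => T r i / T r k).BlockTriangular id := by
    intro i j hij
    by_cases hi : i = k
    · subst hi
      simp [hrow j hij]
    · rw [updateRow_ne hi]
      exact one_apply_ne (ne_of_gt hij)
  have t₂ : (updateCol (1 : Matrix (Fin n) (Fin n) F) r
      fun j => T j k).BlockTriangular id := by
    intro i j hij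
    by_cases hj : j = r
    · subst hj
      simp [hcol i hij]
    · rw [updateCol_ne hj]
      exact one_apply_ne (ne_of_gt hij)
  refine ⟨_, _, t₁.isUnit_iff.2 fun i => ?_, t₂.isUnit_iff.2 fun j => ?_, t₁, t₂, ?_⟩
  · by_cases hi : i = k
    · subst hi
      simp [hrk]
    · simp [updateRow_ne hi]
  · by_cases hj : j = r
    · subst hj
      simp [hrk]
    · simp [updateCol_ne hj]
  · have left : updateCol (1 : Matrix (Fin n) (Fin n) F) r (fun j => T j k) * clearPivot T r k =
        of fun j i => T j i - T j k * (T r i / T r k) + if i = k then T j k else 0 := by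
      ext j i
      have : ∀ l, updateCol (1 : Matrix (Fin n) (Fin n) F) r (fun j => T j k) j l =
          (1 : Matrix (Fin n) (Fin n) F) j l +
            if l = r then T j k - (1 : Matrix (Fin n) (Fin n) F) j r else 0 := by
        intro l
        rw [updateCol_apply]
        split_ifs with h
        · subst h; ring
        · ring
      simp only [mul_apply, this, add_mul, Finset.sum_add_distrib, ite_mul, zero_mul,
        Finset.sum_ite_eq', Finset.mem_univ, if_true]
      simp only [one_apply, ite_mul, one_mul, zero_mul, Finset.sum_ite_eq, Finset.mem_univ,
        if_true, clearPivot, of_apply, mul_div_cancel₀ _ hrk]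
      by_cases hj : j = r <;> by_cases hi : i = k <;> simp [hj, hi, hrk, mul_div_cancel₀]
    rw [left]
    ext j i
    have : ∀ l, updateRow (1 : Matrix (Fin m) (Fin m) F) k (fun i => T r i / T r k) l i =
        (1 : Matrix (Fin m) (Fin m) F) l i +
          if l = k then T r i / T r k - (1 : Matrix (Fin m) (Fin m) F) k i else 0 := by
      intro l
      rw [updateRow_apply]
      split_ifs with h
      · subst h; ring
      · ring
    simp only [mul_apply, of_apply, this, mul_add, Finset.sum_add_distrib, mul_ite, mul_zero,
      Finset.sum_ite_eq', Finset.mem_univ, if_true]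
    simp only [one_apply, mul_ite, mul_one, mul_zero, Finset.sum_ite_eq', Finset.mem_univ,
      if_true]
    by_cases hi : i = k
    · subst hi
      simp [hrk]
    · simp [hi, Ne.symm hi, hrk]

/-- The entry in row `j` and column `i` is `1` and is the only nonzero one in its row and column. -/
structure IsIsolatedOne {F : Type*} [Field F] {m n : ℕ} (T : Matrix (Fin n) (Fin m) F)
    (j : Fin n) (i : Fin m) : Prop where
  eq_one : T j i = 1
  col : ∀ j', T j' i ≠ 0 → j' = j
  row : ∀ i', T j i' ≠ 0 → i' = i

theorem exists_borelEquiv_isolated_lt {F : Type*} [Field F] {m n : ℕ}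
    (T : Matrix (Fin n) (Fin m) F) (k : ℕ) (hk : k ≤ m) :
    ∃ T', BorelEquiv T T' ∧ ∀ i : Fin m, (i : ℕ) < k → ∀ j, T' j i ≠ 0 → IsIsolatedOne T' j i := by
  induction k with
  | zero => exact ⟨T, .refl T, by simp⟩
  | succ k ih =>
    obtain ⟨A, hTA, hA⟩ := ih (by omega)
    let c : Fin m := ⟨k, hk⟩
    have lt_or_eq : ∀ i : Fin m, (i : ℕ) < k + 1 → (i : ℕ) < k ∨ i = c := fun i hi => by
      rcases Nat.lt_succ_iff_lt_or_eq.1 hi with h | h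
      · exact .inl h
      · exact .inr (Fin.ext h)
    by_cases hz : ∀ j, A j c = 0
    · refine ⟨A, hTA, fun i hi j hj => ?_⟩
      rcases lt_or_eq i hi with h | rfl
      · exact hA i h j hj
      · exact absurd (hz j) hj
    push Not at hz
    obtain ⟨r, hr, hmax⟩ := (Set.toFinite {j | A j c ≠ 0}).exists_maximal hz
    have hr : A r c ≠ 0 := hr
    have hcol : ∀ j, r < j → A j c = 0 := fun j hj => by
      by_contra h
      exact absurd (hmax h hj.le) (not_le.2 hj)
    have hrow : ∀ i, i < c → A r i = 0 := fun i hi => by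
      by_contra h
      exact hi.ne' ((hA i hi r h).row c hr)
    refine ⟨clearPivot A r c, hTA.trans (borelEquiv_clearPivot A r c hr hcol hrow),
      fun i hi j hj => ?_⟩
    rcases lt_or_eq i hi with h | rfl
    · have hic : i ≠ c := ne_of_lt h
      have eq : ∀ j, clearPivot A r c j i = A j i := fun j => by
        simp [clearPivot, hrow i h, hic]
      rw [eq] at hj
      have iso := hA i h j hj
      have hjc : A j c = 0 := by
        by_contra h'
        exact hic (iso.row c h').symm
      have hjr : j ≠ r := by
        rintro rfl
        exact hr hjc
      refine ⟨by rw [eq, iso.eq_one], fun j' h' => iso.col j' (by rwa [eq] at h'),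
        fun i' h' => iso.row i' ?_⟩
      simpa [clearPivot, hjc, hjr] using h'
    · have eq : ∀ j, clearPivot A r c j c = if j = r then 1 else 0 := fun j => by
        simp [clearPivot, hr]
      have eq' : ∀ i, clearPivot A r c r i = if i = c then 1 else 0 := fun i => by
        simp [clearPivot, mul_div_cancel₀, hr]
      have hjr : j = r := by
        by_contra h
        simp [eq, h] at hj
      subst hjr
      exact ⟨by simp [eq], fun j' h' => by simpa [eq] using h', fun i' h' => by
        simpa [eq'] using h'⟩

theorem exists_borelEquiv_pmMatrix {F : Type*} [Field F] {m n : ℕ}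
    (T : Matrix (Fin n) (Fin m) F) :
    ∃ s : Finset (Fin m × Fin n), IsPartialMatching s ∧ BorelEquiv T (pmMatrix F s) := by
  classical
  obtain ⟨A, hTA, hA⟩ := exists_borelEquiv_isolated_lt T m le_rfl
  have iso : ∀ i j, A j i ≠ 0 → IsIsolatedOne A j i := fun i => hA i i.2
  refine ⟨Finset.univ.filter fun p => A p.2 p.1 ≠ 0, ?_, ?_⟩
  · rintro ⟨i, j⟩ hp ⟨i', j'⟩ hq
    simp only [Finset.mem_filter, Finset.mem_univ, true_and] at hp hq ⊢
    constructor
    · rintro rfl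
      exact (iso i j' hq).col j hp
    · rintro rfl
      exact (iso i' j hq).row i hp
  · convert hTA using 1
    ext j i
    by_cases h : A j i = 0
    · simp [pmMatrix, h]
    · simp [pmMatrix, (iso i j h).eq_one]

theorem IsPartialMatching.mul_pmMatrix_apply {F : Type*} [Field F] {m n : ℕ}
    {s : Finset (Fin m × Fin n)} (hs : IsPartialMatching s) {i : Fin m} {j : Fin n}
    (h : (i, j) ∈ s) (B : Matrix (Fin n) (Fin n) F) (l : Fin n) :
    (B * pmMatrix F s) l i = B l j := by
  rw [mul_apply, Finset.sum_eq_single j]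
  · simp [pmMatrix, h]
  · intro j' _ hj'
    have : (i, j') ∉ s := fun h' => hj' ((hs _ h' _ h).1 rfl)
    simp [pmMatrix, this]
  · simp

theorem IsPartialMatching.pmMatrix_mul_apply {F : Type*} [Field F] {m n : ℕ}
    {s : Finset (Fin m × Fin n)} (hs : IsPartialMatching s) {i : Fin m} {j : Fin n}
    (h : (i, j) ∈ s) (A : Matrix (Fin m) (Fin m) F) (l : Fin m) :
    (pmMatrix F s * A) j l = A i l := by
  rw [mul_apply, Finset.sum_eq_single i]
  · simp [pmMatrix, h]
  · intro i' _ hi'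
    have : (i', j) ∉ s := fun h' => hi' ((hs _ h' _ h).2 rfl)
    simp [pmMatrix, this]
  · simp

/-- If two partial permutation matrices are intertwined by upper-triangular matrices, the
first matching is dominated by the second one. -/
theorem IsPartialMatching.exists_le_of_pmMatrix_mul_eq {F : Type*} [Field F] {m n : ℕ}
    {s t : Finset (Fin m × Fin n)} (hs : IsPartialMatching s) (ht : IsPartialMatching t)
    {A : Matrix (Fin m) (Fin m) F} {B : Matrix (Fin n) (Fin n) F} (hA : A.BlockTriangular id)
    (hAu : IsUnit A) (hB : B.BlockTriangular id) (h : pmMatrix F s * A = B * pmMatrix F t)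
    {i : Fin m} {j : Fin n} (hij : (i, j) ∈ s) : ∃ j', (i, j') ∈ t ∧ j ≤ j' := by
  have hne : (B * pmMatrix F t) j i ≠ 0 := by
    rw [← h, hs.pmMatrix_mul_apply hij]
    exact hA.isUnit_iff.1 hAu i
  obtain ⟨j', hj'⟩ : ∃ j', (i, j') ∈ t := by
    by_contra! hn
    exact hne (by simp [mul_apply, pmMatrix, hn])
  refine ⟨j', hj', not_lt.1 fun hlt => hne ?_⟩
  rw [ht.mul_pmMatrix_apply hj']
  exact hB hlt

theorem IsPartialMatching.subset_of_pmMatrix_mul_eq {F : Type*} [Field F] {m n : ℕ}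
    {s t : Finset (Fin m × Fin n)} (hs : IsPartialMatching s) (ht : IsPartialMatching t)
    {A A' : Matrix (Fin m) (Fin m) F} {B B' : Matrix (Fin n) (Fin n) F}
    (hA : A.BlockTriangular id) (hAu : IsUnit A) (hB : B.BlockTriangular id)
    (hA' : A'.BlockTriangular id) (hAu' : IsUnit A') (hB' : B'.BlockTriangular id)
    (h : pmMatrix F s * A = B * pmMatrix F t) (h' : pmMatrix F t * A' = B' * pmMatrix F s) :
    s ⊆ t := by
  rintro ⟨i, j⟩ hij
  obtain ⟨j', hj', hle⟩ := hs.exists_le_of_pmMatrix_mul_eq ht hA hAu hB h hij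
  obtain ⟨j'', hj'', hle'⟩ := ht.exists_le_of_pmMatrix_mul_eq hs hA' hAu' hB' h' hj'
  obtain rfl : j'' = j := (hs _ hj'' _ hij).1 rfl
  rwa [le_antisymm hle hle']

/-- Orbits of products of Borels (invertible upper-triangular matrices) on
`Mat_{n×m}(F)` are classified by partial matchings: every `T` lies in the orbit of
`x_σ` for exactly one partial matching `σ ∈ PM(m,n)`. -/
theorem existsUnique_partialMatching_orbit (F : Type*) [Field F] (m n : ℕ)
    (T : Matrix (Fin n) (Fin m) F) :
    ∃! σ : {s : Finset (Fin m × Fin n) // IsPartialMatching s},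
      ∃ (b₁ : Matrix (Fin m) (Fin m) F) (b₂ : Matrix (Fin n) (Fin n) F),
        IsUnit b₁ ∧ IsUnit b₂ ∧ b₁.BlockTriangular id ∧ b₂.BlockTriangular id ∧
        T = b₂ * pmMatrix F σ.1 * b₁⁻¹ := by
  refine existsUnique_of_exists_of_unique ?_ ?_
  · obtain ⟨s, hs, b₁, b₂, u₁, u₂, t₁, t₂, h⟩ := exists_borelEquiv_pmMatrix T
    exact ⟨⟨s, hs⟩, b₁⁻¹, b₂, isUnit_nonsing_inv_iff.2 u₁, u₂, t₁.nonsing_inv u₁, t₂, by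
      rw [nonsing_inv_nonsing_inv _ ((isUnit_iff_isUnit_det _).1 u₁), h]⟩
  · rintro ⟨s, hs⟩ ⟨t, ht⟩ ⟨b₁, b₂, u₁, u₂, t₁, t₂, h⟩ ⟨c₁, c₂, v₁, v₂, s₁, s₂, h'⟩
    have intertwine : ∀ {x y : Matrix (Fin n) (Fin m) F} {b₁ c₁ : Matrix (Fin m) (Fin m) F}
        {b₂ c₂ : Matrix (Fin n) (Fin n) F}, IsUnit b₂ → IsUnit c₁ →
        b₂ * x * b₁⁻¹ = c₂ * y * c₁⁻¹ → x * (b₁⁻¹ * c₁) = b₂⁻¹ * c₂ * y := by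
      intro x y b₁ c₁ b₂ c₂ hb hc e
      have hb := (isUnit_iff_isUnit_det _).1 hb
      have hc := (isUnit_iff_isUnit_det _).1 hc
      calc x * (b₁⁻¹ * c₁) = b₂⁻¹ * (b₂ * x * b₁⁻¹) * c₁ := by
            simp only [Matrix.mul_assoc, nonsing_inv_mul_cancel_left _ _ hb]
        _ = b₂⁻¹ * c₂ * y := by
            rw [e]
            simp only [Matrix.mul_assoc, nonsing_inv_mul _ hc, Matrix.mul_one]
    have e := intertwine u₂ v₁ (h.symm.trans h')
    have e' := intertwine v₂ u₁ (h'.symm.trans h)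
    have hA := (t₁.nonsing_inv u₁).mul s₁
    have hA' := (s₁.nonsing_inv v₁).mul t₁
    have hAu := (isUnit_nonsing_inv_iff.2 u₁).mul v₁
    have hAu' := (isUnit_nonsing_inv_iff.2 v₁).mul u₁
    have hB := (t₂.nonsing_inv u₂).mul s₂
    have hB' := (s₂.nonsing_inv v₂).mul t₂
    exact Subtype.ext (Finset.Subset.antisymm
      (hs.subset_of_pmMatrix_mul_eq ht hA hAu hB hA' hAu' hB' e e')
      (ht.subset_of_pmMatrix_mul_eq hs hA' hAu' hB' hA hAu hB e' e))
end

section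
/- Let F be a field and m, n ≥ 1. Let V₂, the symplectic form ⟨·,·⟩, Sp(V₂) and B₂ be as in the context, and let B̄₁ ⊆ GL_m(F) be the group of invertible upper-triangular m×m matrices. Let N ⊆ Hom(F^m, V₂) be the moment cone consisting of all linear maps T such that ⟨Tv, Tw⟩ = 0 for all v, w ∈ F^m (i.e. the image of T is isotropic), with the action (b₁, g)·T = g ∘ T ∘ b₁⁻¹ of B̄₁ × B₂. For σ = (I, J, μ) ∈ SPM(m,n) let x_σ ∈ N be the map with x_σ(e_i) = f_{μ(i)} for i ∈ I⁺ := I ∩ {1,…,m} and x_σ(e_i) = 0 for i ∈ {1,…,m} ∖ I⁺, where e₁,…,e_m is the standard basis of F^m. Then every T ∈ N lies in the (B̄₁ × B₂)-orbit of x_σ for exactly one σ ∈ SPM(m,n); in particular, σ ↦ (B̄₁ × B₂)·x_σ is a bijection from SPM(m,n) onto the set of (B̄₁ × B₂)-orbits on N. -/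
open Matrix

/-- A finset `s ⊆ ℤ × ℤ` is (the graph of) a signed partial matching `(I, J, μ)` between
`{±1,…,±m}` and `{±1,…,±n}`: the entries are bounded, `s` is the graph of a bijection
`μ : I → J`, and `s` is stable under simultaneous negation (so `I = -I`, `J = -J` and
`μ(-a) = -μ(a)`). -/
def IsSignedPM (m n : ℕ) (s : Finset (ℤ × ℤ)) : Prop :=
  (∀ p ∈ s, (1 ≤ |p.1| ∧ |p.1| ≤ (m : ℤ)) ∧ (1 ≤ |p.2| ∧ |p.2| ≤ (n : ℤ))) ∧
  (∀ p ∈ s, ∀ q ∈ s, p.1 = q.1 ↔ p.2 = q.2) ∧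
  (∀ p ∈ s, (-p.1, -p.2) ∈ s)

/-- The Gram matrix of the symplectic form on `V₂ = F^{2n}` with basis
`f₁,…,f_n,f_{-n},…,f_{-1}`, determined by `⟨f_i, f_{-i}⟩ = 1 = -⟨f_{-i}, f_i⟩`. -/
def sympForm (F : Type*) [Zero F] [One F] [Neg F] (n : ℕ) :
    Matrix (Fin (2 * n)) (Fin (2 * n)) F :=
  fun a b => if (a : ℕ) + (b : ℕ) + 1 = 2 * n then (if (a : ℕ) < n then 1 else -1) else 0

/-- The index (in `Fin (2n)`) of the basis vector `f_j` for a signed index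
`j ∈ {±1,…,±n}`: `f_j` has index `j - 1` for `1 ≤ j ≤ n`, and `f_{-i}` has index
`2n - i`. -/
def signedToIdx (n : ℕ) (j : ℤ) : ℕ :=
  if 0 < j then j.toNat - 1 else 2 * n - (-j).toNat

/-- The element `x_σ ∈ Hom(F^m, V₂)` attached to a signed partial matching `σ`:
`x_σ(e_i) = f_{μ(i)}` for `i ∈ I⁺ = I ∩ {1,…,m}` and `x_σ(e_i) = 0` otherwise. -/
def spmMatrix (F : Type*) [Zero F] [One F] (m n : ℕ) (s : Finset (ℤ × ℤ)) :
    Matrix (Fin (2 * n)) (Fin m) F :=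
  fun a c =>
    if (s.filter fun p => p.1 = ((c : ℕ) + 1 : ℤ) ∧ (a : ℕ) = signedToIdx n p.2).Nonempty
    then 1 else 0

section SympForm

variable {F : Type*} [Field F] {n : ℕ}

theorem fin_add_add_one_eq_iff (a b : Fin (2 * n)) :
    (a : ℕ) + (b : ℕ) + 1 = 2 * n ↔ b = a.rev := by
  rw [Fin.ext_iff, Fin.val_rev]; omega

theorem fin_rev_ne_self (a : Fin (2 * n)) : a.rev ≠ a := by
  rw [Ne, Fin.ext_iff, Fin.val_rev]; omega

/-- The sign `⟨f_a, f_{-a}⟩`, as a function of the index of `f_a`. -/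
def sympSign (F : Type*) [Field F] (n : ℕ) (a : Fin (2 * n)) : F :=
  if (a : ℕ) < n then 1 else -1

theorem sympSign_mul_self (a : Fin (2 * n)) : sympSign F n a * sympSign F n a = 1 := by
  unfold sympSign; split_ifs <;> simp

theorem sympSign_ne_zero (a : Fin (2 * n)) : sympSign F n a ≠ 0 := by
  unfold sympSign; split_ifs <;> simp

theorem sympSign_rev (a : Fin (2 * n)) : sympSign F n a.rev = -sympSign F n a := by
  have := Fin.val_rev a
  unfold sympSign
  split_ifs <;> first | omega | simp

theorem sympForm_apply (a b : Fin (2 * n)) :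
    sympForm F n a b = if b = a.rev then sympSign F n a else 0 := by
  simp only [sympForm, fin_add_add_one_eq_iff, sympSign]

theorem sympForm_mulVec (x : Fin (2 * n) → F) (a : Fin (2 * n)) :
    (sympForm F n *ᵥ x) a = sympSign F n a * x a.rev := by
  simp [mulVec, dotProduct, sympForm_apply]

theorem sympForm_transpose : (sympForm F n)ᵀ = -sympForm F n := by
  ext a b
  rw [transpose_apply, neg_apply, sympForm_apply, sympForm_apply]
  by_cases h : b = a.rev
  · subst h; simp [sympSign_rev]
  · have : a ≠ b.rev := fun h' => h (by rw [h', Fin.rev_rev])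
    simp [h, this]

theorem sympForm_mul_self : sympForm F n * sympForm F n = -1 := by
  refine Matrix.ext_of_mulVec_single fun i => ?_
  ext a
  rw [← mulVec_mulVec, sympForm_mulVec, sympForm_mulVec, sympSign_rev, Fin.rev_rev,
    ← mul_assoc, mul_neg, sympSign_mul_self, neg_mulVec, one_mulVec]
  simp

theorem dotProduct_sympForm_mulVec_self (x : Fin (2 * n) → F) :
    x ⬝ᵥ (sympForm F n *ᵥ x) = 0 := by
  refine Finset.sum_involution (fun a _ => a.rev) ?_ ?_ ?_ ?_
  · intro a _
    rw [sympForm_mulVec, sympForm_mulVec, sympSign_rev, Fin.rev_rev]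
    ring
  · intro a _ _
    exact fin_rev_ne_self a
  · simp
  · simp

theorem vecMul_sympForm (x : Fin (2 * n) → F) :
    x ᵥ* sympForm F n = -(sympForm F n *ᵥ x) := by
  rw [← mulVec_transpose, sympForm_transpose, neg_mulVec]

theorem dotProduct_sympForm_mulVec_comm (x y : Fin (2 * n) → F) :
    x ⬝ᵥ (sympForm F n *ᵥ y) = -(y ⬝ᵥ (sympForm F n *ᵥ x)) := by
  rw [dotProduct_mulVec, vecMul_sympForm, neg_dotProduct, dotProduct_comm]

/-- Membership of a matrix in the Borel subgroup `B₂` of the symplectic group. -/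
structure IsSympBorel (g : Matrix (Fin (2 * n)) (Fin (2 * n)) F) : Prop where
  symp : gᵀ * sympForm F n * g = sympForm F n
  flag : ∀ a b : Fin (2 * n), (b : ℕ) < n → (b : ℕ) < (a : ℕ) → g a b = 0

namespace IsSympBorel

variable {g h : Matrix (Fin (2 * n)) (Fin (2 * n)) F}

theorem isUnit (hg : IsSympBorel g) : IsUnit g := by
  refine IsUnit.of_mul_eq_one_right (a := -(sympForm F n * gᵀ * sympForm F n)) ?_
  rw [neg_mul, mul_assoc, mul_assoc, ← mul_assoc gᵀ, hg.symp, sympForm_mul_self, neg_neg]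

theorem blockTriangular (hg : IsSympBorel g) : g.BlockTriangular id := by
  obtain ⟨hs, hf⟩ := id hg
  have hmin : g.BlockTriangular (fun i : Fin (2 * n) => min (i : ℕ) n) := by
    intro i j hij
    have hij : min (j : ℕ) n < min (i : ℕ) n := hij
    exact hf i j (by omega) (by omega)
  have := hg.isUnit.invertible
  have hinv := blockTriangular_inv_of_blockTriangular hmin
  have key : sympForm F n * g = (g⁻¹)ᵀ * sympForm F n := by
    rw [← hs, ← mul_assoc, ← mul_assoc, ← transpose_mul, mul_inv_of_invertible, transpose_one,
      one_mul, hs]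
  intro i j hij
  have hij' : (j : ℕ) < i := hij
  by_cases hj : (j : ℕ) < n
  · exact hf i j hj hij
  have hji := congrFun (congrFun key i.rev) j
  have hr := Fin.val_rev i
  have hr' := Fin.val_rev j
  have hz : g⁻¹ j.rev i.rev = 0 := hinv (by change min _ _ < min _ _; omega)
  have hL : (sympForm F n * g) i.rev j = sympSign F n i.rev * g i j := by
    have := sympForm_mulVec (fun k => g k j) i.rev
    rw [Fin.rev_rev] at this
    exact this
  have hR : ((g⁻¹)ᵀ * sympForm F n) i.rev j = 0 := by
    rw [mul_apply]
    refine Finset.sum_eq_zero fun k _ => ?_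
    rw [transpose_apply, sympForm_apply]
    split_ifs with h
    · have : k = j.rev := by rw [h, Fin.rev_rev]
      rw [this, hz, zero_mul]
    · rw [mul_zero]
  rw [hL, hR] at hji
  exact (mul_eq_zero.mp hji).resolve_left (sympSign_ne_zero _)

theorem of_blockTriangular (hs : gᵀ * sympForm F n * g = sympForm F n)
    (ht : g.BlockTriangular id) : IsSympBorel g :=
  ⟨hs, fun _ _ _ hab => ht hab⟩

theorem mul (hg : IsSympBorel g) (hh : IsSympBorel h) : IsSympBorel (g * h) := by
  refine of_blockTriangular ?_ (hg.blockTriangular.mul hh.blockTriangular)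
  calc (g * h)ᵀ * sympForm F n * (g * h) = hᵀ * (gᵀ * sympForm F n * g) * h := by
        simp only [transpose_mul, mul_assoc]
    _ = sympForm F n := by rw [hg.symp, hh.symp]

theorem one : IsSympBorel (1 : Matrix (Fin (2 * n)) (Fin (2 * n)) F) :=
  of_blockTriangular (by simp) blockTriangular_one

end IsSympBorel

/-- The Siegel transformation `x ↦ x + ⟨x, e⟩ w + ⟨x, w⟩ e + c ⟨x, e⟩ e`;
it is symplectic when `⟨w, e⟩ = 0`. -/
def siegel (e w : Fin (2 * n) → F) (c : F) : Matrix (Fin (2 * n)) (Fin (2 * n)) F :=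
  1 + vecMulVec w (sympForm F n *ᵥ e) + vecMulVec e (sympForm F n *ᵥ w + c • (sympForm F n *ᵥ e))

theorem siegel_symp (e w : Fin (2 * n) → F) (c : F) (h : w ⬝ᵥ (sympForm F n *ᵥ e) = 0) :
    (siegel e w c)ᵀ * sympForm F n * siegel e w c = sympForm F n := by
  have h' : e ⬝ᵥ (sympForm F n *ᵥ w) = 0 := by
    rw [dotProduct_sympForm_mulVec_comm, h, neg_zero]
  have he := dotProduct_sympForm_mulVec_self e
  have hw := dotProduct_sympForm_mulVec_self w
  rw [dotProduct_comm] at h h' he hw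
  set p := sympForm F n *ᵥ e with hp
  set q := sympForm F n *ᵥ w with hq
  have h1 : (siegel e w c)ᵀ * sympForm F n =
      sympForm F n - (vecMulVec p q + vecMulVec (q + c • p) p) := by
    rw [siegel, transpose_add, transpose_add, transpose_one, transpose_vecMulVec,
      transpose_vecMulVec, add_mul, add_mul, one_mul, vecMulVec_mul, vecMulVec_mul,
      vecMul_sympForm, vecMul_sympForm, ← hp, ← hq, vecMulVec_neg, vecMulVec_neg]
    abel
  rw [h1, siegel, ← hp, ← hq]
  simp only [mul_add, mul_one, sub_mul, add_mul, mul_vecMulVec, ← hp, ← hq,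
    vecMulVec_mulVec, h, h', he, hw, MulOpposite.op_zero, zero_smul, zero_vecMulVec, add_zero,
    sub_zero]
  ext i j
  simp only [Matrix.add_apply, Matrix.sub_apply, vecMulVec_apply, Pi.add_apply, Pi.smul_apply,
    smul_eq_mul]
  ring

theorem siegel_mulVec_single (e w : Fin (2 * n) → F) (c : F) (s i : Fin (2 * n)) :
    (siegel e w c *ᵥ Pi.single s 1) i = (Pi.single s 1 : Fin (2 * n) → F) i +
      sympSign F n s * (e s.rev * w i + (w s.rev + c * e s.rev) * e i) := by
  rw [mulVec_single_one, col_apply, siegel]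
  simp only [Matrix.add_apply, vecMulVec_apply, sympForm_mulVec, one_apply, Pi.single_apply, Pi.add_apply,
    Pi.smul_apply, smul_eq_mul]
  ring

/-- A vector with leading coordinate `1` at `a` is the image of the basis vector at `a` under an
element of `B₂` that fixes all other basis vectors orthogonal to it. -/
theorem exists_isSympBorel_mulVec_single (v : Fin (2 * n) → F) (a : Fin (2 * n)) (hva : v a = 1)
    (hv : ∀ i, a < i → v i = 0) :
    ∃ g : Matrix (Fin (2 * n)) (Fin (2 * n)) F, IsSympBorel g ∧ g *ᵥ Pi.single a 1 = v ∧
      ∀ s, s ≠ a → v s.rev = 0 → g *ᵥ Pi.single s 1 = Pi.single s 1 := by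
  set ε := sympSign F n a with hε
  have hεε : ε * ε = 1 := sympSign_mul_self a
  set e : Fin (2 * n) → F := Pi.single a.rev 1 with he
  set w : Fin (2 * n) → F := fun i => if i = a ∨ i = a.rev then 0 else ε * v i with hw
  have hes : ∀ s, e s.rev = if s = a then 1 else 0 := by
    intro s
    simp [he, Pi.single_apply, Fin.rev_inj]
  have hwz : ∀ i, v i = 0 → w i = 0 := by
    intro i hi
    simp [hw, hi]
  have hws : ∀ i, a ≤ i → w i = 0 := by
    intro i hi
    rcases hi.eq_or_lt with rfl | hi
    · simp [hw]
    · exact hwz i (hv i hi)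
  refine ⟨siegel e w (ε * v a.rev), .of_blockTriangular (siegel_symp _ _ _ ?_) ?_, ?_, ?_⟩
  · rw [dotProduct]
    refine Finset.sum_eq_zero fun i _ => ?_
    rw [sympForm_mulVec, hes]
    split_ifs with hi
    · rw [hws i hi.ge, zero_mul]
    · simp
  · intro i j hij
    have hij : j < i := hij
    have := siegel_mulVec_single e w (ε * v a.rev) j i
    rw [mulVec_single_one, col_apply] at this
    rw [this, Pi.single_eq_of_ne hij.ne', zero_add, hes]
    by_cases hja : j = a
    · subst hja
      by_cases hi : i = j.rev
      · rw [hws i hij.le, hv j.rev (hi ▸ hij)]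
        simp [hw]
      · rw [hws i hij.le]
        simp [he, hi, hw]
    · by_cases hi : i = a.rev
      · have : a < j.rev := by rwa [Fin.lt_rev_iff, ← hi]
        simp [hja, hws _ this.le]
      · simp [he, hi, hja]
  · ext i
    rw [siegel_mulVec_single, hes, if_pos rfl, ← hε]
    have hwr : w a.rev = 0 := by simp [hw]
    rw [hwr]
    by_cases hi : i = a
    · subst hi
      simp [hw, he, (fin_rev_ne_self i).symm, hva]
    · by_cases hi' : i = a.rev
      · subst hi'
        simp [hi, hw, he, ← mul_assoc, hεε]
      · simp [hi, hi', hw, he, ← mul_assoc, hεε]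
  · intro s hs hvs
    ext i
    rw [siegel_mulVec_single, hes, if_neg hs, hwz _ hvs]
    ring

end SympForm

section PartialPermutation

/-- A matrix with entries `0` and `1`, with at most one `1` in every row and column. -/
structure IsPartialPerm {ι κ F : Type*} [Zero F] [One F] (P : Matrix ι κ F) : Prop where
  zero_or_one : ∀ a c, P a c = 0 ∨ P a c = 1
  row : ∀ a c c', P a c ≠ 0 → P a c' ≠ 0 → c = c'
  col : ∀ a a' c, P a c ≠ 0 → P a' c ≠ 0 → a = a'

theorem Matrix.BlockTriangular.diag_ne_zero {F ι : Type*} [Field F] [Fintype ι] [DecidableEq ι]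
    [LinearOrder ι] {M : Matrix ι ι F} (hM : M.BlockTriangular id) (hu : IsUnit M) (i : ι) :
    M i i ≠ 0 := by
  rw [isUnit_iff_isUnit_det, det_of_isUpperTriangular hM, isUnit_iff_ne_zero,
    Finset.prod_ne_zero_iff] at hu
  exact hu i (Finset.mem_univ i)

/-- Partial permutation matrices are determined by their orbit under multiplication by invertible
upper triangular matrices on both sides. -/
theorem IsPartialPerm.eq_of_mul_eq_mul {F : Type*} [Field F] {k m : ℕ}
    {P Q : Matrix (Fin k) (Fin m) F} (hP : IsPartialPerm P) (hQ : IsPartialPerm Q)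
    {b : Matrix (Fin m) (Fin m) F} {g : Matrix (Fin k) (Fin k) F}
    (hb : b.BlockTriangular id) (hb₀ : IsUnit b) (hg : g.BlockTriangular id) (hg₀ : IsUnit g)
    (h : P * b = g * Q) : P = Q := by
  suffices H : ∀ N : ℕ, ∀ (a : Fin k) (c : Fin m), (c : ℕ) + (k - a) = N → P a c = Q a c by
    ext a c
    exact H _ a c rfl
  intro N
  induction N using Nat.strong_induction_on with
  | _ N ih =>
    intro a c hN
    have hrow : ∀ c' < c, P a c' = Q a c' := fun c' hc' =>
      ih _ (by have : (c' : ℕ) < c := hc'; omega) a c' rfl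
    have hcol : ∀ a' > a, P a' c = Q a' c := fun a' ha' =>
      ih _ (by have : (a : ℕ) < a' := ha'; omega) a' c rfl
    have hac := congrFun (congrFun h a) c
    rw [mul_apply, mul_apply] at hac
    rcases hP.zero_or_one a c with hPz | hPo <;> rcases hQ.zero_or_one a c with hQz | hQo
    · rw [hPz, hQz]
    · exfalso
      have hQne : Q a c ≠ 0 := by simp [hQo]
      rw [Finset.sum_eq_zero, Finset.sum_eq_single a, hQo, mul_one] at hac
      · exact hg.diag_ne_zero hg₀ a hac.symm
      · intro a' _ ha'
        by_contra hne
        exact ha' (hQ.col _ _ c (right_ne_zero_of_mul hne) hQne)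
      · simp
      · intro c' _
        by_contra hne
        rcases lt_trichotomy c' c with hc | rfl | hc
        · exact hc.ne (hQ.row a _ _ (hrow c' hc ▸ left_ne_zero_of_mul hne) hQne)
        · exact left_ne_zero_of_mul hne hPz
        · exact right_ne_zero_of_mul hne (hb hc)
    · exfalso
      have hPne : P a c ≠ 0 := by simp [hPo]
      rw [Finset.sum_eq_single c, Finset.sum_eq_zero, hPo, one_mul] at hac
      · exact hb.diag_ne_zero hb₀ c hac
      · intro a' _
        by_contra hne
        rcases lt_trichotomy a' a with ha | rfl | ha
        · exact left_ne_zero_of_mul hne (hg ha)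
        · exact right_ne_zero_of_mul hne hQz
        · exact ha.ne' (hP.col _ _ c (hcol a' ha ▸ right_ne_zero_of_mul hne) hPne)
      · intro c' _ hc'
        by_contra hne
        exact hc' (hP.row a _ _ (left_ne_zero_of_mul hne) hPne)
      · simp
    · rw [hPo, hQo]

end PartialPermutation

section SignedPM

variable {m n : ℕ}

/-- The signed index `j` of the basis vector `f_j` with a given position. -/
def idxToSigned (n a : ℕ) : ℤ :=
  if a < n then a + 1 else a - 2 * n

theorem signedToIdx_idxToSigned {a : ℕ} (ha : a < 2 * n) :
    signedToIdx n (idxToSigned n a) = a := by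
  unfold signedToIdx idxToSigned
  split_ifs <;> omega

theorem idxToSigned_signedToIdx {j : ℤ} (h₁ : 1 ≤ |j|) (h₂ : |j| ≤ n) :
    idxToSigned n (signedToIdx n j) = j := by
  unfold signedToIdx idxToSigned
  rcases abs_cases j with ⟨h, _⟩ | ⟨h, _⟩ <;> split_ifs <;> omega

theorem signedToIdx_lt {j : ℤ} (h₁ : 1 ≤ |j|) (h₂ : |j| ≤ n) : signedToIdx n j < 2 * n := by
  unfold signedToIdx
  rcases abs_cases j with ⟨h, _⟩ | ⟨h, _⟩ <;> split_ifs <;> omega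

theorem abs_idxToSigned {a : ℕ} (ha : a < 2 * n) :
    1 ≤ |idxToSigned n a| ∧ |idxToSigned n a| ≤ n := by
  unfold idxToSigned
  split_ifs
  · rw [abs_of_pos (by omega)]; omega
  · rw [abs_of_neg (by omega)]; omega

theorem idxToSigned_inj {a b : ℕ} (ha : a < 2 * n) (hb : b < 2 * n) :
    idxToSigned n a = idxToSigned n b ↔ a = b :=
  ⟨fun h => by rw [← signedToIdx_idxToSigned ha, h, signedToIdx_idxToSigned hb], fun h => h ▸ rfl⟩

theorem add_add_one_of_idxToSigned_eq_neg {a b : ℕ} (ha : a < 2 * n) (hb : b < 2 * n)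
    (h : idxToSigned n a = -idxToSigned n b) : a + b + 1 = 2 * n := by
  unfold idxToSigned at h
  split_ifs at h <;> omega

variable {F : Type*} [Field F] {s t : Finset (ℤ × ℤ)}

open Classical in
theorem IsSignedPM.spmMatrix_apply (hs : IsSignedPM m n s) (a : Fin (2 * n)) (c : Fin m) :
    spmMatrix F m n s a c = if ((c : ℤ) + 1, idxToSigned n a) ∈ s then 1 else 0 := by
  unfold spmMatrix
  refine if_congr ⟨?_, fun h => ?_⟩ rfl rfl
  · rintro ⟨⟨x, y⟩, hp⟩
    obtain ⟨hp, rfl, ha⟩ := Finset.mem_filter.mp hp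
    obtain ⟨-, h₁, h₂⟩ := hs.1 _ hp
    rwa [ha, idxToSigned_signedToIdx h₁ h₂]
  · exact ⟨_, Finset.mem_filter.mpr ⟨h, rfl, (signedToIdx_idxToSigned a.2).symm⟩⟩

theorem IsSignedPM.spmMatrix_ne_zero_iff (hs : IsSignedPM m n s) (a : Fin (2 * n)) (c : Fin m) :
    spmMatrix F m n s a c ≠ 0 ↔ ((c : ℤ) + 1, idxToSigned n a) ∈ s := by
  simp [hs.spmMatrix_apply]

theorem IsSignedPM.isPartialPerm (hs : IsSignedPM m n s) : IsPartialPerm (spmMatrix F m n s) where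
  zero_or_one a c := by
    unfold spmMatrix
    split_ifs <;> simp
  row a c c' h h' := by
    rw [hs.spmMatrix_ne_zero_iff] at h h'
    have := (hs.2.1 _ h _ h').mpr rfl
    ext
    simpa using this
  col a a' c h h' := by
    rw [hs.spmMatrix_ne_zero_iff] at h h'
    have := (hs.2.1 _ h _ h').mp rfl
    ext
    exact (idxToSigned_inj a.2 a'.2).mp this

theorem IsSignedPM.subset_of_spmMatrix_eq (hs : IsSignedPM m n s) (ht : IsSignedPM m n t)
    (h : spmMatrix F m n s = spmMatrix F m n t) : s ⊆ t := by
  have hpos : ∀ x y, 0 < x → (x, y) ∈ s → (x, y) ∈ t := by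
    intro x y hx hxy
    obtain ⟨⟨hx₁, hx₂⟩, hy₁, hy₂⟩ := hs.1 _ hxy
    simp only at hx₁ hx₂ hy₁ hy₂
    rw [abs_of_pos hx] at hx₁ hx₂
    have hxc : x = (((⟨x.toNat - 1, by omega⟩ : Fin m) : ℕ) : ℤ) + 1 := by
      simp only
      omega
    have hya : idxToSigned n ((⟨signedToIdx n y, signedToIdx_lt hy₁ hy₂⟩ : Fin (2 * n)) : ℕ) = y :=
      idxToSigned_signedToIdx hy₁ hy₂
    rw [hxc, ← hya] at hxy ⊢
    rwa [← ht.spmMatrix_ne_zero_iff (F := F), ← h, hs.spmMatrix_ne_zero_iff]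
  rintro ⟨x, y⟩ hxy
  have hx := (hs.1 _ hxy).1.1
  simp only at hx
  rcases lt_or_ge 0 x with hx₀ | hx₀
  · exact hpos x y hx₀ hxy
  · have hneg : x ≠ 0 := by rintro rfl; simp at hx
    have := ht.2.2 _ (hpos _ _ (by omega) (hs.2.2 _ hxy))
    simpa using this

theorem IsSignedPM.eq_of_spmMatrix_eq (hs : IsSignedPM m n s) (ht : IsSignedPM m n t)
    (h : spmMatrix F m n s = spmMatrix F m n t) : s = t :=
  (hs.subset_of_spmMatrix_eq ht h).antisymm (ht.subset_of_spmMatrix_eq hs h.symm)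

/-- A partial permutation matrix with isotropic image is the matrix of a signed partial matching. -/
theorem IsPartialPerm.exists_spmMatrix_eq {X : Matrix (Fin (2 * n)) (Fin m) F}
    (hX : IsPartialPerm X) (hiso : Xᵀ * sympForm F n * X = 0) :
    ∃ s, IsSignedPM m n s ∧ spmMatrix F m n s = X := by
  classical
  have hno : ∀ a a' c c', X a c ≠ 0 → X a' c' ≠ 0 →
      idxToSigned n (a : Fin (2 * n)) ≠ -idxToSigned n (a' : Fin (2 * n)) := by
    intro a a' c c' h h' heq
    have hrev := (fin_add_add_one_eq_iff a a').mp (add_add_one_of_idxToSigned_eq_neg a.2 a'.2 heq)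
    have hz := congrFun (congrFun hiso c) c'
    rw [Matrix.mul_assoc, mul_apply, Finset.sum_eq_single a] at hz
    · have hJ : (sympForm F n * X) a c' = sympSign F n a * X a.rev c' :=
        sympForm_mulVec (fun k => X k c') a
      rw [hJ, ← hrev, transpose_apply] at hz
      exact mul_ne_zero h (mul_ne_zero (sympSign_ne_zero a) h') hz
    · intro a'' _ hne
      by_contra hne'
      exact hne (hX.col _ _ c (left_ne_zero_of_mul hne') h)
    · simp
  set pos : Finset (ℤ × ℤ) :=
    (Finset.univ.filter fun p : Fin (2 * n) × Fin m => X p.1 p.2 ≠ 0).image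
      fun p => ((p.2 : ℤ) + 1, idxToSigned n p.1) with hpos
  have hmem : ∀ p, p ∈ pos ∪ pos.image (fun p => (-p.1, -p.2)) ↔ ∃ a c, X a c ≠ 0 ∧
      (p = ((c : ℤ) + 1, idxToSigned n a) ∨ p = (-((c : ℤ) + 1), -idxToSigned n a)) := by
    intro p
    simp only [hpos, Finset.mem_union, Finset.mem_image, Finset.mem_filter, Finset.mem_univ,
      true_and, Prod.exists]
    constructor
    · rintro (⟨a, c, h, rfl⟩ | ⟨_, _, ⟨a, c, h, h'⟩, rfl⟩)
      · exact ⟨a, c, h, .inl rfl⟩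
      · obtain ⟨rfl, rfl⟩ := Prod.ext_iff.mp h'
        exact ⟨a, c, h, .inr rfl⟩
    · rintro ⟨a, c, h, rfl | rfl⟩
      · exact .inl ⟨a, c, h, rfl⟩
      · exact .inr ⟨_, _, ⟨a, c, h, rfl⟩, rfl⟩
  have hcr : ∀ a a' c c', X a c ≠ 0 → X a' c' ≠ 0 →
      ((c : ℤ) + 1 = (c' : ℤ) + 1 ↔ idxToSigned n a = idxToSigned n a') := by
    intro a a' c c' h h'
    rw [idxToSigned_inj a.2 a'.2, ← Fin.ext_iff, add_left_inj, Nat.cast_inj, ← Fin.ext_iff]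
    constructor
    · rintro rfl
      exact hX.col _ _ _ h h'
    · rintro rfl
      exact hX.row _ _ _ h h'
  have hs : IsSignedPM m n (pos ∪ pos.image (fun p => (-p.1, -p.2))) := by
    refine ⟨?_, ?_, ?_⟩
    · intro p hp
      obtain ⟨a, c, -, rfl | rfl⟩ := (hmem p).mp hp
      · refine ⟨?_, abs_idxToSigned a.2⟩
        simp only [abs_of_pos (show (0 : ℤ) < (c : ℤ) + 1 by omega)]
        omega
      · simp only [abs_neg, abs_of_pos (show (0 : ℤ) < (c : ℤ) + 1 by omega)]
        exact ⟨by omega, abs_idxToSigned a.2⟩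
    · intro p hp q hq
      obtain ⟨a, c, h, rfl | rfl⟩ := (hmem p).mp hp <;>
        obtain ⟨a', c', h', rfl | rfl⟩ := (hmem q).mp hq
      · exact hcr a a' c c' h h'
      · exact iff_of_false (by simp only; omega) (hno a a' c c' h h')
      · exact iff_of_false (by simp only; omega) (fun e => hno a' a c' c h' h e.symm)
      · simp only [neg_inj]
        exact hcr a a' c c' h h'
    · intro p hp
      obtain ⟨a, c, h, rfl | rfl⟩ := (hmem p).mp hp
      · exact (hmem _).mpr ⟨a, c, h, .inr rfl⟩
      · exact (hmem _).mpr ⟨a, c, h, .inl (by simp)⟩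
  refine ⟨_, hs, ?_⟩
  ext a c
  rw [hs.spmMatrix_apply]
  have key : ((c : ℤ) + 1, idxToSigned n a) ∈ pos ∪ pos.image (fun p => (-p.1, -p.2)) ↔
      X a c ≠ 0 := by
    rw [hmem]
    constructor
    · rintro ⟨a', c', h, h' | h'⟩ <;> obtain ⟨h₁, h₂⟩ := Prod.ext_iff.mp h' <;>
        simp only at h₁ h₂
      · have hc : c = c' := by ext; omega
        have ha : a = a' := Fin.ext ((idxToSigned_inj a.2 a'.2).mp h₂)
        rwa [hc, ha]
      · omega
    · exact fun h => ⟨a, c, h, .inl rfl⟩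
  rcases hX.zero_or_one a c with h | h <;> simp [key, h]

end SignedPM

section Reduction

variable {F : Type*} [Field F] {m n : ℕ}

/-- `T` lies in the orbit of `X` under `B̄₁ × B₂`. -/
def OrbitRel (T X : Matrix (Fin (2 * n)) (Fin m) F) : Prop :=
  ∃ (b : Matrix (Fin m) (Fin m) F) (g : Matrix (Fin (2 * n)) (Fin (2 * n)) F),
    IsUnit b ∧ b.BlockTriangular id ∧ IsSympBorel g ∧ T * b = g * X

namespace OrbitRel

variable {T X Y : Matrix (Fin (2 * n)) (Fin m) F}

theorem refl (T : Matrix (Fin (2 * n)) (Fin m) F) : OrbitRel T T :=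
  ⟨1, 1, isUnit_one, blockTriangular_one, .one, by simp⟩

theorem trans (h : OrbitRel T X) (h' : OrbitRel X Y) : OrbitRel T Y := by
  obtain ⟨b, g, hb, hbt, hg, e⟩ := h
  obtain ⟨b', g', hb', hbt', hg', e'⟩ := h'
  refine ⟨b * b', g * g', hb.mul hb', hbt.mul hbt', hg.mul hg', ?_⟩
  rw [← Matrix.mul_assoc, e, Matrix.mul_assoc, e', Matrix.mul_assoc]

theorem isotropic (h : OrbitRel T X) (hT : Tᵀ * sympForm F n * T = 0) :
    Xᵀ * sympForm F n * X = 0 := by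
  obtain ⟨b, g, -, -, hg, e⟩ := h
  calc Xᵀ * sympForm F n * X = Xᵀ * (gᵀ * sympForm F n * g) * X := by rw [hg.symp]
    _ = (g * X)ᵀ * sympForm F n * (g * X) := by simp only [transpose_mul, Matrix.mul_assoc]
    _ = bᵀ * (Tᵀ * sympForm F n * T) * b := by
        rw [← e]; simp only [transpose_mul, Matrix.mul_assoc]
    _ = 0 := by simp [hT]

/-- Column operations by upper triangular matrices. -/
theorem updateCol (T : Matrix (Fin (2 * n)) (Fin m) F) (k : Fin m) (u : Fin m → F) (hk : u k ≠ 0)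
    (hu : ∀ c, k < c → u c = 0) : OrbitRel T (T.updateCol k (T *ᵥ u)) := by
  have ht : ((1 : Matrix (Fin m) (Fin m) F).updateCol k u).BlockTriangular id := by
    intro i j hij
    have hij : j < i := hij
    rw [updateCol_apply]
    split_ifs with h
    · exact hu i (h ▸ hij)
    · exact one_apply_ne hij.ne'
  refine ⟨(1 : Matrix (Fin m) (Fin m) F).updateCol k u, 1, ?_, ht, .one, ?_⟩
  · rw [isUnit_iff_isUnit_det, det_of_isUpperTriangular ht, isUnit_iff_ne_zero,
      Finset.prod_ne_zero_iff]
    intro i _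
    rw [updateCol_apply]
    split_ifs with h
    · exact h ▸ hk
    · simp
  · rw [Matrix.one_mul]
    ext a c
    by_cases h : c = k
    · subst h
      simp [mul_apply, mulVec, dotProduct]
    · simp [mul_apply, h, one_apply]

end OrbitRel

/-- The first `k` columns of `X` form a partial permutation matrix. -/
def IsReducedTo (k : ℕ) (X : Matrix (Fin (2 * n)) (Fin m) F) : Prop :=
  ∀ c : Fin m, (c : ℕ) < k → X.col c = 0 ∨ ∃ a, X.col c = Pi.single a 1 ∧
    ∀ c' : Fin m, (c' : ℕ) < k → c' ≠ c → X a c' = 0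

theorem IsReducedTo.isPartialPerm {X : Matrix (Fin (2 * n)) (Fin m) F} (hX : IsReducedTo m X) :
    IsPartialPerm X where
  zero_or_one a c := by
    rcases hX c c.2 with h | ⟨a', h, -⟩ <;> rw [← col_apply X, h]
    · exact .inl rfl
    · rw [Pi.single_apply]
      split_ifs <;> simp
  row a c c' h h' := by
    rcases hX c c.2 with h₀ | ⟨a', h₀, hr⟩ <;> rw [← col_apply X, h₀] at h
    · exact absurd rfl h
    · by_contra hne
      have : a = a' := by
        by_contra ha
        exact h (Pi.single_eq_of_ne ha 1)
      exact h' (this ▸ hr c' c'.2 (Ne.symm hne))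
  col a a' c h h' := by
    rcases hX c c.2 with h₀ | ⟨b, h₀, -⟩ <;> rw [← col_apply X, h₀] at h h'
    · exact absurd rfl h
    · have key : ∀ x, (Pi.single b 1 : Fin (2 * n) → F) x ≠ 0 → x = b := fun x hx => by
        by_contra hne
        exact hx (Pi.single_eq_of_ne hne 1)
      rw [key a' h']
      exact key a h

/-- A column can be modified by earlier columns so that it vanishes at the pivots of these columns
and at the opposite indices. -/
theorem IsReducedTo.exists_column_combination {X : Matrix (Fin (2 * n)) (Fin m) F} {k : Fin m}
    (hX : IsReducedTo k X) (hiso : Xᵀ * sympForm F n * X = 0) :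
    ∃ u : Fin m → F, u k = 1 ∧ (∀ c, k < c → u c = 0) ∧
      ∀ c < k, ∀ a, X.col c = Pi.single a 1 → (X *ᵥ u) a = 0 ∧ (X *ᵥ u) a.rev = 0 := by
  set q : Fin m → F := fun c => if c < k then X.col c ⬝ᵥ X.col k else 0 with hq
  refine ⟨Pi.single k 1 - q, by simp [hq], ?_, ?_⟩
  · intro c hc
    simp [hq, hc.ne', hc.le]
  · intro c hc a ha
    constructor
    · have hXac : X a c = 1 := by rw [← col_apply X, ha, Pi.single_eq_same]
      have hrow : ∀ c' < k, c' ≠ c → X a c' = 0 := by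
        rcases hX c hc with h | ⟨a', h, hr⟩
        · rw [← col_apply X, h] at hXac
          simp at hXac
        · have : a = a' := by
            by_contra hne
            rw [← col_apply X, h, Pi.single_eq_of_ne hne] at hXac
            simp at hXac
          subst this
          exact hr
      have hqc : (X *ᵥ q) a = X a k := by
        rw [mulVec, dotProduct, Finset.sum_eq_single c]
        · simp [hq, hc, ha, hXac]
        · intro c' _ hne
          by_cases h : c' < k
          · rw [hrow c' h hne, zero_mul]
          · simp [hq, h]
        · simp
      rw [mulVec_sub, Pi.sub_apply, hqc, mulVec_single_one, col_apply, sub_self]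
    · have hz : (Xᵀ * sympForm F n * X) *ᵥ (Pi.single k 1 - q) = 0 := by rw [hiso, zero_mulVec]
      have hz := congrFun hz c
      rw [← mulVec_mulVec, ← mulVec_mulVec] at hz
      change X.col c ⬝ᵥ _ = 0 at hz
      rw [ha, single_one_dotProduct, sympForm_mulVec] at hz
      exact (mul_eq_zero.mp hz).resolve_left (sympSign_ne_zero a)

theorem IsReducedTo.exists_succ {X : Matrix (Fin (2 * n)) (Fin m) F} {k : Fin m}
    (hX : IsReducedTo k X) (hiso : Xᵀ * sympForm F n * X = 0) :
    ∃ Y, OrbitRel X Y ∧ IsReducedTo (k + 1) Y := by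
  classical
  obtain ⟨u, huk, hu, hpiv⟩ := hX.exists_column_combination hiso
  by_cases hv : X *ᵥ u = 0
  · refine ⟨_, .updateCol X k u (by simp [huk]) hu, ?_⟩
    rw [hv]
    intro c hc
    by_cases hck : c = k
    · left
      ext a
      simp [hck]
    · have hc' : (c : ℕ) < k := by
        have : (c : ℕ) ≠ k := fun h => hck (Fin.ext h)
        omega
      have hcol : (X.updateCol k 0).col c = X.col c := by
        ext a
        simp [hck]
      rw [hcol]
      refine (hX c hc').imp id fun ⟨a, ha, hr⟩ => ⟨a, ha, fun c' hc'k hne => ?_⟩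
      rw [updateCol_apply]
      split_ifs with h
      · rfl
      · have : (c' : ℕ) ≠ k := fun h' => h (Fin.ext h')
        exact hr c' (by omega) hne
  · have hne : (Finset.univ.filter fun a => (X *ᵥ u) a ≠ 0).Nonempty := by
      obtain ⟨a, ha⟩ := Function.ne_iff.mp hv
      exact ⟨a, by simpa using ha⟩
    obtain ⟨a, ha, hmax⟩ := Finset.exists_max_image _ id hne
    rw [Finset.mem_filter] at ha
    set l := ((X *ᵥ u) a)⁻¹ with hl
    have hl₀ : l ≠ 0 := inv_ne_zero ha.2
    have hlu : X *ᵥ (l • u) = l • (X *ᵥ u) := mulVec_smul ..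
    set v := X *ᵥ (l • u) with hvdef
    have hva : v a = 1 := by rw [hlu, Pi.smul_apply, smul_eq_mul, inv_mul_cancel₀ ha.2]
    obtain ⟨g, hg, hga, hgs⟩ := exists_isSympBorel_mulVec_single v a hva (by
      intro i hi
      by_contra h
      refine hi.not_ge (hmax i ?_)
      rw [hlu] at h
      simpa using right_ne_zero_of_mul h)
    have hpiv' : ∀ c < k, ∀ s, X.col c = Pi.single s 1 → s ≠ a ∧ v s.rev = 0 := by
      intro c hc s hs
      obtain ⟨h₁, h₂⟩ := hpiv c hc s hs
      refine ⟨?_, by rw [hlu, Pi.smul_apply, h₂, smul_zero]⟩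
      rintro rfl
      exact ha.2 h₁
    have hginv : g⁻¹ * g = 1 := nonsing_inv_mul g ((isUnit_iff_isUnit_det g).mp hg.isUnit)
    have hinv : ∀ x y, g *ᵥ x = y → g⁻¹ *ᵥ y = x := by
      rintro x _ rfl
      rw [mulVec_mulVec, hginv, one_mulVec]
    set Y := g⁻¹ * X.updateCol k v with hY
    have hYcol : ∀ c, Y.col c = g⁻¹ *ᵥ (X.updateCol k v).col c := fun c => rfl
    have hYk : Y.col k = Pi.single a 1 := by
      rw [hYcol]
      refine hinv _ _ (hga.trans ?_)
      ext i
      simp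
    have hYc : ∀ c < k, Y.col c = X.col c := by
      intro c hc
      have h : (X.updateCol k v).col c = X.col c := by
        ext i
        simp [hc.ne]
      rw [hYcol, h]
      refine hinv _ _ ?_
      rcases hX c hc with h | ⟨s, hs, -⟩
      · rw [h, mulVec_zero]
      · rw [hs]
        exact hgs s (hpiv' c hc s hs).1 (hpiv' c hc s hs).2
    refine ⟨Y, (OrbitRel.updateCol X k (l • u) (by simp [huk, hl₀]) ?_).trans
      ⟨1, g, isUnit_one, blockTriangular_one, hg, ?_⟩, ?_⟩
    · intro c hc
      simp [hu c hc]
    · rw [Matrix.mul_one, hY, ← Matrix.mul_assoc,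
        mul_nonsing_inv g ((isUnit_iff_isUnit_det g).mp hg.isUnit), Matrix.one_mul]
    · have hcase : ∀ c : Fin m, (c : ℕ) < k + 1 → c < k ∨ c = k := by
        intro c hc
        rw [Fin.lt_def, Fin.ext_iff]
        omega
      intro c hc
      rcases hcase c hc with hck | rfl
      · rw [hYc c hck]
        refine (hX c hck).imp id fun ⟨s, hs, hr⟩ => ⟨s, hs, fun c' hc' hne => ?_⟩
        rw [← col_apply Y]
        rcases hcase c' hc' with hc'k | rfl
        · rw [hYc c' hc'k]
          exact hr c' hc'k hne
        · rw [hYk, Pi.single_eq_of_ne (hpiv' c hck s hs).1]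
      · refine .inr ⟨a, hYk, fun c' hc' hne => ?_⟩
        have hc'k := (hcase c' hc').resolve_right hne
        rw [← col_apply Y, hYc c' hc'k]
        rcases hX c' hc'k with h | ⟨s, hs, -⟩
        · rw [h, Pi.zero_apply]
        · rw [hs, Pi.single_eq_of_ne (hpiv' c' hc'k s hs).1.symm]

theorem exists_orbitRel_isPartialPerm (T : Matrix (Fin (2 * n)) (Fin m) F)
    (hT : Tᵀ * sympForm F n * T = 0) : ∃ X, OrbitRel T X ∧ IsPartialPerm X := by
  have key : ∀ k ≤ m, ∃ X, OrbitRel T X ∧ IsReducedTo k X := by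
    intro k
    induction k with
    | zero => exact fun _ => ⟨T, .refl T, fun c hc => absurd hc (Nat.not_lt_zero _)⟩
    | succ k ih =>
      intro hk
      obtain ⟨X, hTX, hX⟩ := ih (by omega)
      obtain ⟨Y, hXY, hY⟩ := IsReducedTo.exists_succ (k := ⟨k, hk⟩) hX (hTX.isotropic hT)
      exact ⟨Y, hTX.trans hXY, hY⟩
  obtain ⟨X, hTX, hX⟩ := key m le_rfl
  exact ⟨X, hTX, hX.isPartialPerm⟩

theorem OrbitRel.eq_of_isPartialPerm {T P Q : Matrix (Fin (2 * n)) (Fin m) F}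
    (hTP : OrbitRel T P) (hTQ : OrbitRel T Q) (hP : IsPartialPerm P) (hQ : IsPartialPerm Q) :
    P = Q := by
  obtain ⟨b, g, hb, hbt, hg, e⟩ := hTP
  obtain ⟨b', g', hb', hbt', hg', e'⟩ := hTQ
  have := hb.invertible
  have := hg.isUnit.invertible
  refine hP.eq_of_mul_eq_mul hQ (b := b⁻¹ * b') (g := g⁻¹ * g')
    ((blockTriangular_inv_of_blockTriangular hbt).mul hbt') ((isUnit_nonsing_inv_iff.mpr hb).mul hb')
    ((blockTriangular_inv_of_blockTriangular hg.blockTriangular).mul hg'.blockTriangular)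
    ((isUnit_nonsing_inv_iff.mpr hg.isUnit).mul hg'.isUnit) ?_
  have hT : T = g * P * b⁻¹ := by
    rw [← e, Matrix.mul_assoc, mul_inv_of_invertible, Matrix.mul_one]
  have hP' : P * b⁻¹ = g⁻¹ * T := by
    rw [hT, Matrix.mul_assoc, ← Matrix.mul_assoc, inv_mul_of_invertible, Matrix.one_mul]
  rw [← Matrix.mul_assoc, hP', Matrix.mul_assoc, e', Matrix.mul_assoc]

theorem orbitRel_iff {T X : Matrix (Fin (2 * n)) (Fin m) F} :
    OrbitRel T X ↔
      ∃ (b₁ : Matrix (Fin m) (Fin m) F) (g : Matrix (Fin (2 * n)) (Fin (2 * n)) F),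
        IsUnit b₁ ∧ b₁.BlockTriangular id ∧
        IsUnit g ∧ gᵀ * sympForm F n * g = sympForm F n ∧
        (∀ a b : Fin (2 * n), (b : ℕ) < n → (b : ℕ) < (a : ℕ) → g a b = 0) ∧
        T = g * X * b₁⁻¹ := by
  refine exists₂_congr fun b g => and_congr_right fun hb => and_congr_right fun _ => ?_
  have := hb.invertible
  have e : T * b = g * X ↔ T = g * X * b⁻¹ := by
    constructor
    · intro h
      rw [← h, Matrix.mul_assoc, mul_inv_of_invertible, Matrix.mul_one]
    · intro h
      rw [h, Matrix.mul_assoc, inv_mul_of_invertible, Matrix.mul_one]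
  rw [e]
  exact ⟨fun ⟨hg, h⟩ => ⟨hg.isUnit, hg.symp, hg.flag, h⟩, fun ⟨_, hs, hf, h⟩ => ⟨⟨hs, hf⟩, h⟩⟩

end Reduction

/-- Orbits of `B̄₁ × B₂` on the moment cone
`N = {T ∈ Hom(F^m, V₂) | the image of T is isotropic}` are classified by signed partial
matchings: every `T ∈ N` lies in the orbit of `x_σ` for exactly one `σ ∈ SPM(m,n)`. -/
theorem existsUnique_signedPartialMatching_orbit (F : Type*) [Field F] (m n : ℕ)
    (hm : 1 ≤ m) (hn : 1 ≤ n) (T : Matrix (Fin (2 * n)) (Fin m) F)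
    (hT : Tᵀ * sympForm F n * T = 0) :
    ∃! σ : {s : Finset (ℤ × ℤ) // IsSignedPM m n s},
      ∃ (b₁ : Matrix (Fin m) (Fin m) F) (g : Matrix (Fin (2 * n)) (Fin (2 * n)) F),
        IsUnit b₁ ∧ b₁.BlockTriangular id ∧
        IsUnit g ∧ gᵀ * sympForm F n * g = sympForm F n ∧
        (∀ a b : Fin (2 * n), (b : ℕ) < n → (b : ℕ) < (a : ℕ) → g a b = 0) ∧
        T = g * spmMatrix F m n σ.1 * b₁⁻¹ := by
  simp only [← orbitRel_iff]
  obtain ⟨X, hTX, hX⟩ := exists_orbitRel_isPartialPerm T hT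
  obtain ⟨s, hs, rfl⟩ := hX.exists_spmMatrix_eq (hTX.isotropic hT)
  refine ⟨⟨s, hs⟩, hTX, fun ⟨t, ht⟩ hTt => Subtype.ext ?_⟩
  exact ht.eq_of_spmMatrix_eq hs (hTt.eq_of_isPartialPerm hTX ht.isPartialPerm hs.isPartialPerm)
end
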